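/- arXiv:1403.1172 — 3 statements merged into one kernel-verified Lean document; each statement's English description precedes it below -/
import Mathlib

section
/- Let A ∈ Z^{r×(r+c-1)} be a degree matrix with all rows equal, with column degrees a_1 ≤ a_2 ≤ ... ≤ a_{r+c-1}, and let s = deg hp^A. Then for every i with 0 ≤ i ≤ a_{r+1} - 1, the coefficient h_{s-i} of z^{s-i} in hp^A equals binom(r+c-2,c-1)·binom(c+i-1,c-1) + Σ_{α=1}^{c-1} (-1)^α binom(r-α+c-2, c-1-α) Σ_{1≤j_1<...<j_α≤r} binom(c+i-1-a_{j_1}-...-a_{j_α}, c-1), with binomial coefficients vanishing for negative or out-of-range arguments. -/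
open Polynomial

/-- The polynomial `1 + z + ⋯ + z^(d-1)`. -/
noncomputable def geom (d : ℤ) : Polynomial ℤ :=
  ∑ i ∈ Finset.range d.toNat, Polynomial.X ^ i

/-- The h-polynomial of a standard determinantal ideal with `t × m` degree matrix `A`
(codimension `m - t + 1`), defined via the basic-double-link recursion applied at the
bottom-right entry, with the conventions `hp = 0` for `t = 0` and `hp = 1` for `m < t`. -/
noncomputable def hp : (t m : ℕ) → Matrix (Fin t) (Fin m) ℤ → Polynomial ℤ
  | 0, _, _ => 0
  | _ + 1, 0, _ => 1
  | t + 1, m + 1, A =>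
    if m + 1 ≤ t then 1
    else
      Polynomial.X ^ (A (Fin.last t) (Fin.last m)).toNat *
          hp t m (fun i j => A i.castSucc j.castSucc) +
        geom (A (Fin.last t) (Fin.last m)) * hp (t + 1) m (fun i j => A i j.castSucc)
  termination_by t m => (t, m)

/-- Delete row `k` and column `l` of a matrix. -/
def delRC {t m : ℕ} (A : Matrix (Fin (t + 1)) (Fin (m + 1)) ℤ)
    (k : Fin (t + 1)) (l : Fin (m + 1)) : Matrix (Fin t) (Fin m) ℤ :=
  fun i j => A (k.succAbove i) (l.succAbove j)

/-- Delete column `l` of a matrix. -/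
def delC {t m : ℕ} (A : Matrix (Fin t) (Fin (m + 1)) ℤ) (l : Fin (m + 1)) :
    Matrix (Fin t) (Fin m) ℤ :=
  fun i j => A i (l.succAbove j)

/-- `A` is a degree matrix: homogeneous (`a_{i,j} = b_j - a_i`), entries weakly increasing
left-to-right and bottom-to-top, and positive on the main diagonal. -/
def IsDegreeMatrix {a b : ℕ} (A : Matrix (Fin a) (Fin b) ℤ) : Prop :=
  (∃ (α : Fin a → ℤ) (β : Fin b → ℤ), ∀ i j, A i j = β j - α i) ∧
    (∀ (i : Fin a) (j j' : Fin b), j ≤ j' → A i j ≤ A i j') ∧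
    (∀ (i i' : Fin a) (j : Fin b), i ≤ i' → A i' j ≤ A i j) ∧
    (∀ (i : Fin a) (h : (i : ℕ) < b), 0 < A i ⟨i, h⟩)

/-- Binomial coefficient with integer top argument, with the convention that it vanishes
whenever the top argument is negative or smaller than the bottom one. -/
def ch (a : ℤ) (b : ℕ) : ℤ := if a < 0 then 0 else (a.toNat).choose b

/-- `h : ℕ → ℤ` is a pure O-sequence: it is the f-vector (counting monomials by degree)
of a nonempty finite order ideal of monomials all of whose maximal elements have the
same degree. -/
def IsPureOSequence (h : ℕ → ℤ) : Prop :=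
  ∃ (N : ℕ) (Γ : Finset (Fin N → ℕ)),
    Γ.Nonempty ∧
      (∀ μ ∈ Γ, ∀ ν : Fin N → ℕ, ν ≤ μ → ν ∈ Γ) ∧
      (∃ d : ℕ, ∀ μ ∈ Γ, (∀ ν ∈ Γ, μ ≤ ν → μ = ν) → ∑ j, μ j = d) ∧
      (∀ i : ℕ, ((Γ.filter fun μ => ∑ j, μ j = i).card : ℤ) = h i)


def Mb (b : ℕ → ℕ) (t m : ℕ) : Matrix (Fin t) (Fin m) ℤ := fun _ j => ((b j + 1 : ℕ) : ℤ)

noncomputable def es (b : ℕ → ℕ) (α m : ℕ) : ℤ[X] :=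
  ∑ J ∈ Finset.powersetCard α (Finset.range m), X ^ (∑ j ∈ J, (b j + 1))

lemma es_zero (b : ℕ → ℕ) (m : ℕ) : es b 0 m = 1 := by simp [es]

lemma es_self (b : ℕ → ℕ) (m : ℕ) : es b m m = X ^ (∑ j ∈ Finset.range m, (b j + 1)) := by
  have h := Finset.powersetCard_self (Finset.range m)
  rw [Finset.card_range] at h
  simp [es, h]

lemma es_succ (b : ℕ → ℕ) (α m : ℕ) :
    es b (α + 1) (m + 1) = es b (α + 1) m + X ^ (b m + 1) * es b α m := by
  unfold es
  rw [Finset.range_add_one, Finset.powersetCard_succ_insert (by simp), Finset.sum_union]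
  · congr 1
    rw [Finset.sum_image, Finset.mul_sum]
    · refine Finset.sum_congr rfl fun J hJ => ?_
      have : m ∉ J := fun h => by
        have := (Finset.mem_powersetCard.1 hJ).1 h
        simp at this
      rw [Finset.sum_insert this, pow_add]
    · intro J hJ K hK h
      have h1 : m ∉ J := fun h => by
        have := (Finset.mem_powersetCard.1 hJ).1 h
        simp at this
      have h2 : m ∉ K := fun h => by
        have := (Finset.mem_powersetCard.1 hK).1 h
        simp at this
      rw [← Finset.erase_insert h1, ← Finset.erase_insert h2]
      exact congrArg (fun s => Finset.erase s m) h
  · rw [Finset.disjoint_left]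
    intro J hJ hK
    obtain ⟨K, hK, rfl⟩ := Finset.mem_image.1 hK
    have := (Finset.mem_powersetCard.1 hJ).1 (Finset.mem_insert_self m K)
    simp at this

noncomputable def FF (b : ℕ → ℕ) (t k m : ℕ) : ℤ[X] :=
  ∑ α ∈ Finset.range k, (-1) ^ α * (((t + k - 1 - α).choose t : ℕ) : ℤ[X]) * es b α m
    + (-1) ^ k * es b m m

lemma es_top (b : ℕ → ℕ) (m : ℕ) : es b (m + 1) m = 0 := by
  unfold es
  rw [Finset.powersetCard_eq_empty.2 (by simp)]
  simp

lemma FF_zero_succ (b : ℕ → ℕ) (k : ℕ) :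
    FF b 0 (k + 1) (k + 1) = (1 - X ^ (b k + 1)) * FF b 0 k k := by
  unfold FF
  simp only [Nat.choose_zero_right, Nat.cast_one, mul_one]
  rw [← Finset.sum_range_succ (fun α => (-1 : ℤ[X]) ^ α * es b α (k + 1)),
    ← Finset.sum_range_succ (fun α => (-1 : ℤ[X]) ^ α * es b α k), Finset.sum_range_succ', sub_mul,
    one_mul]
  simp only [es_succ, es_zero]
  have h : ∑ α ∈ Finset.range (k + 1), (-1 : ℤ[X]) ^ α * es b α k =
    ∑ α ∈ Finset.range (k + 1), (-1 : ℤ[X]) ^ (α + 1) * es b (α + 1) k + 1 := by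
    have := Finset.sum_range_succ' (fun α => (-1 : ℤ[X]) ^ α * es b α k) (k + 1)
    rw [Finset.sum_range_succ] at this
    simpa [es_top, es_zero] using this
  conv_rhs => rw [h, ← h]
  conv_rhs => enter [1]; rw [h]
  rw [Finset.mul_sum]
  simp only [mul_add, Finset.sum_add_distrib]
  have : ∑ x ∈ Finset.range (k + 1), (-1 : ℤ[X]) ^ (x + 1) * (X ^ (b k + 1) * es b x k)
    = - ∑ x ∈ Finset.range (k + 1), X ^ (b k + 1) * ((-1 : ℤ[X]) ^ x * es b x k) := by
    rw [← Finset.sum_neg_distrib]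
    exact Finset.sum_congr rfl fun x _ => by ring
  rw [this]
  ring

lemma FF_succ_succ (b : ℕ → ℕ) (t k m : ℕ) (hm : m = t + k + 1) :
    FF b (t + 1) (k + 1) (m + 1) = FF b t (k + 1) m + (1 - X ^ (b m + 1)) * FF b (t + 1) k m := by
  have e1 : ∑ α ∈ Finset.range k, (-1 : ℤ[X]) ^ α * (((t + 1 + k - 1 - α).choose (t + 1) : ℕ) : ℤ[X]) * es b α m
     = ∑ α ∈ Finset.range (k + 1), (-1 : ℤ[X]) ^ α * (((t + k - α).choose (t + 1) : ℕ) : ℤ[X]) * es b α m := by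
    rw [Finset.sum_range_succ]
    have : (t + k - k).choose (t + 1) = 0 := Nat.choose_eq_zero_of_lt (by omega)
    rw [this]
    simp only [Nat.cast_zero, mul_zero, zero_mul, add_zero]
    refine Finset.sum_congr rfl fun α _ => ?_
    rw [show t + 1 + k - 1 - α = t + k - α by omega]
  have e2 : ∑ α ∈ Finset.range (k + 1), (-1 : ℤ[X]) ^ α * (((t + 1 + (k + 1) - 1 - α).choose (t + 1) : ℕ) : ℤ[X]) * es b α (m + 1)
     = ∑ α ∈ Finset.range (k + 1), (-1 : ℤ[X]) ^ α * (((t + 1 + k - α).choose (t + 1) : ℕ) : ℤ[X]) * es b α m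
      - X ^ (b m + 1) * ∑ α ∈ Finset.range k, (-1 : ℤ[X]) ^ α * (((t + 1 + k - 1 - α).choose (t + 1) : ℕ) : ℤ[X]) * es b α m := by
    rw [Finset.sum_range_succ', Finset.sum_range_succ' _ k, Finset.mul_sum, add_sub_right_comm, ← Finset.sum_sub_distrib]
    congr 1
    · refine Finset.sum_congr rfl fun α _ => ?_
      rw [es_succ, show t + 1 + (k + 1) - 1 - (α + 1) = t + k - α by omega,
        show t + 1 + k - (α + 1) = t + k - α by omega, show t + 1 + k - 1 - α = t + k - α by omega]
      ring
    · simp [es_zero]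
  have e3 : ∑ α ∈ Finset.range (k + 1), (-1 : ℤ[X]) ^ α * (((t + 1 + k - α).choose (t + 1) : ℕ) : ℤ[X]) * es b α m
     = ∑ α ∈ Finset.range (k + 1), (-1 : ℤ[X]) ^ α * (((t + (k + 1) - 1 - α).choose t : ℕ) : ℤ[X]) * es b α m
     + ∑ α ∈ Finset.range (k + 1), (-1 : ℤ[X]) ^ α * (((t + k - α).choose (t + 1) : ℕ) : ℤ[X]) * es b α m := by
    rw [← Finset.sum_add_distrib]
    refine Finset.sum_congr rfl fun α hα => ?_
    have := Finset.mem_range.1 hα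
    rw [show t + 1 + k - α = (t + k - α) + 1 by omega, Nat.choose_succ_succ,
      show t + (k + 1) - 1 - α = t + k - α by omega]
    push_cast
    ring
  have e4 : es b (m + 1) (m + 1) = X ^ (b m + 1) * es b m m := by
    rw [es_succ, es_top, zero_add]
  unfold FF
  rw [e2, e3, e4, ← e1]
  ring

lemma geom_reflect (n : ℕ) : reflect n (geom ((n + 1 : ℕ) : ℤ)) = geom ((n + 1 : ℕ) : ℤ) := by
  ext i
  rw [coeff_reflect]
  simp only [geom, Int.toNat_natCast, finsetSum_coeff, coeff_X_pow, Finset.sum_ite_eq,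
    Finset.mem_range]
  by_cases h : i ≤ n
  · rw [revAt_le h]
    simp [h, Nat.lt_succ_iff]
  · rw [revAt_eq_self_of_lt (by omega)]

lemma geom_deg (n : ℕ) : (geom ((n + 1 : ℕ) : ℤ)).natDegree ≤ n := by
  rw [geom]
  refine natDegree_sum_le_of_forall_le _ _ fun i hi => ?_
  rw [natDegree_X_pow]
  simp at hi
  omega

lemma geom_mul (n : ℕ) : (1 - X) * geom (n : ℤ) = 1 - X ^ n := by
  rw [geom, Int.toNat_natCast]
  exact mul_neg_geom_sum X n

lemma hp_zero (m : ℕ) (A : Matrix (Fin 0) (Fin m) ℤ) : hp 0 m A = 0 := by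
  rw [hp]

lemma hp_small (t : ℕ) (A : Matrix (Fin (t + 1)) (Fin t) ℤ) : hp (t + 1) t A = 1 := by
  cases t with
  | zero => rw [hp]
  | succ t => rw [hp, if_pos le_rfl]

lemma hp_step (b : ℕ → ℕ) (t m : ℕ) (h : t ≤ m) : hp (t + 1) (m + 1) (Mb b (t + 1) (m + 1)) =
    X ^ (b m + 1) * hp t m (Mb b t m) + geom ((b m + 1 : ℕ) : ℤ) * hp (t + 1) m (Mb b (t + 1) m) := by
  rw [hp, if_neg (by omega)]
  rfl

lemma reflect_X_pow_self (n : ℕ) : reflect n (X ^ n : ℤ[X]) = 1 := by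
  have := reflect_monomial n n (R := ℤ)
  simpa using this

lemma main_formula (b : ℕ → ℕ) (m : ℕ) : ∀ t k : ℕ, m = t + k →
    (hp (t + 1) m (Mb b (t + 1) m)).natDegree ≤ ∑ j ∈ Finset.range m, b j + t ∧
    (1 - X) ^ k * reflect (∑ j ∈ Finset.range m, b j + t) (hp (t + 1) m (Mb b (t + 1) m))
      = FF b t k m := by
  induction m with
  | zero =>
    intro t k h
    obtain rfl : t = 0 := by omega
    obtain rfl : k = 0 := by omega
    rw [hp_small]
    simp [FF, es_zero]
  | succ m ih =>
    intro t k h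
    rcases k with _ | k
    · obtain rfl : t = m + 1 := by omega
      rw [hp_small]
      simp [FF, es_self, Finset.sum_add_distrib]
    · rw [hp_step b t m (by omega), Finset.sum_range_succ]
      rcases t with _ | t
      · obtain ⟨h1, h2⟩ := ih 0 k (by omega)
        obtain rfl : m = k := by omega
        simp only [hp_zero, mul_zero, zero_add, add_zero] at *
        rw [add_comm (∑ j ∈ Finset.range m, b j)]
        refine ⟨natDegree_mul_le.trans (add_le_add (geom_deg _) h1), ?_⟩
        rw [reflect_mul _ _ (geom_deg _) h1, geom_reflect, FF_zero_succ, ← h2, ← geom_mul]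
        ring
      · obtain ⟨h1, h2⟩ := ih t (k + 1) (by omega)
        obtain ⟨h3, h4⟩ := ih (t + 1) k (by omega)
        have hX : (X ^ (b m + 1) : ℤ[X]).natDegree ≤ b m + 1 := by simp
        have e1 : ∑ j ∈ Finset.range m, b j + b m + (t + 1)
          = (b m + 1) + (∑ j ∈ Finset.range m, b j + t) := by ring
        have e2 : ∑ j ∈ Finset.range m, b j + b m + (t + 1)
          = b m + (∑ j ∈ Finset.range m, b j + (t + 1)) := by ring
        constructor
        · refine natDegree_add_le_of_degree_le ?_ ?_
          · rw [e1]
            exact natDegree_mul_le.trans (add_le_add hX h1)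
          · rw [e2]
            exact natDegree_mul_le.trans (add_le_add (geom_deg _) h3)
        · rw [reflect_add]
          conv_lhs => enter [2, 1]; rw [e1]
          conv_lhs => enter [2, 2]; rw [e2]
          rw [reflect_mul _ _ hX h1, reflect_mul _ _ (geom_deg _) h3, geom_reflect,
            reflect_X_pow_self, FF_succ_succ b t k m (by omega), ← h2, ← h4, ← geom_mul]
          ring

lemma es_coeff_zero (b : ℕ → ℕ) (α m : ℕ) : (es b (α + 1) m).coeff 0 = 0 := by
  unfold es
  rw [finsetSum_coeff]
  refine Finset.sum_eq_zero fun J hJ => ?_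
  rw [coeff_X_pow, if_neg]
  have h1 := (Finset.mem_powersetCard.1 hJ).2
  have : ∑ j ∈ J, 1 ≤ ∑ j ∈ J, (b j + 1) := Finset.sum_le_sum fun _ _ => by omega
  simp only [Finset.sum_const, smul_eq_mul, mul_one] at this
  omega

lemma FF_coeff_zero (b : ℕ → ℕ) (t k : ℕ) :
    (FF b t (k + 1) (t + (k + 1))).coeff 0 = ((t + k).choose t : ℤ) := by
  unfold FF
  have h := es_coeff_zero b
  rw [Finset.sum_range_succ', ← add_assoc t k 1]
  simp only [coeff_add, finsetSum_coeff, mul_coeff_zero, h, mul_zero, es_zero]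
  simp

lemma hp_natDegree (b : ℕ → ℕ) (t k : ℕ) :
    (hp (t + 1) (t + (k + 1)) (Mb b (t + 1) (t + (k + 1)))).natDegree =
      ∑ j ∈ Finset.range (t + (k + 1)), b j + t := by
  obtain ⟨h1, h2⟩ := main_formula b _ t (k + 1) rfl
  refine le_antisymm h1 (le_natDegree_of_ne_zero ?_)
  have h3 := congrArg (fun p => coeff p 0) h2
  simp only [FF_coeff_zero, mul_coeff_zero] at h3
  intro h
  have h0 := coeff_reflect (∑ j ∈ Finset.range (t + (k + 1)), b j + t)
    (hp (t + 1) (t + (k + 1)) (Mb b (t + 1) (t + (k + 1)))) 0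
  rw [revAt_zero, h] at h0
  rw [h0, mul_zero] at h3
  have := Nat.choose_pos (show t ≤ t + k by omega)
  omega

noncomputable def LL (d i : ℕ) : ℤ[X] →+ ℤ where
  toFun p := PowerSeries.coeff i ((p : PowerSeries ℤ) *
    (PowerSeries.mk fun n => ((Nat.choose (d + n) d : ℕ) : ℤ)))
  map_zero' := by simp
  map_add' p q := by simp [add_mul]

lemma LL_X_pow (d i s : ℕ) : LL d i (X ^ s) = ch ((d : ℤ) + i - s) d := by
  change PowerSeries.coeff i (((X ^ s : ℤ[X]) : PowerSeries ℤ) * _) = _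
  rw [Polynomial.coe_pow, Polynomial.coe_X, PowerSeries.coeff_X_pow_mul']
  unfold ch
  split_ifs with h1 h2 h2
  · omega
  · rw [PowerSeries.coeff_mk, show ((d : ℤ) + i - s).toNat = d + (i - s) by omega]
  · rfl
  · rw [Nat.choose_eq_zero_of_lt (by omega)]
    rfl

lemma LL_mul (d i : ℕ) (g : ℤ[X]) : LL d i ((1 - X) ^ (d + 1) * g) = g.coeff i := by
  change PowerSeries.coeff i ((((1 - X) ^ (d + 1) * g : ℤ[X]) : PowerSeries ℤ) * _) = _
  have h := PowerSeries.mk_add_choose_mul_one_sub_pow_eq_one ℤ d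
  have h2 : (((1 - X) ^ (d + 1) * g : ℤ[X]) : PowerSeries ℤ)
      = (1 - PowerSeries.X) ^ (d + 1) * (g : PowerSeries ℤ) := by
    simp
  rw [h2, mul_comm, ← mul_assoc, h, one_mul, Polynomial.coeff_coe]

lemma LL_es (b : ℕ → ℕ) (d i n m α : ℕ) (hnm : n ≤ m)
    (hi : ∀ j, n ≤ j → j < m → i < b j + 1) :
    LL d i (es b α m) = ∑ J ∈ Finset.powersetCard α (Finset.univ : Finset (Fin n)),
      ch ((d : ℤ) + i - ((∑ j ∈ J, (b j + 1) : ℕ) : ℤ)) d := by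
  unfold es
  rw [map_sum]
  simp only [LL_X_pow]
  rw [← Finset.sum_subset (Finset.powersetCard_mono (Finset.range_mono hnm))]
  · have h : Finset.range n = (Finset.univ : Finset (Fin n)).map Fin.valEmbedding := by
      ext x
      simp only [Finset.mem_range, Finset.mem_map, Finset.mem_univ, true_and,
        Fin.valEmbedding_apply]
      exact ⟨fun h => ⟨⟨x, h⟩, rfl⟩, by rintro ⟨y, rfl⟩; exact y.2⟩
    rw [h, Finset.powersetCard_map, Finset.sum_map]
    refine Finset.sum_congr rfl fun J _ => ?_
    simp [Finset.mapEmbedding_apply]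
  · intro J hJ hJ'
    rw [Finset.mem_powersetCard] at hJ hJ'
    have : ∃ j ∈ J, n ≤ j := by
      by_contra! hcon
      exact hJ' ⟨fun j hj => Finset.mem_range.2 (hcon j hj), hJ.2⟩
    obtain ⟨j, hj, hnj⟩ := this
    have h1 := hi j hnj (Finset.mem_range.1 (hJ.1 hj))
    have h2 : b j + 1 ≤ ∑ j ∈ J, (b j + 1) :=
      Finset.single_le_sum (f := fun j => b j + 1) (fun _ _ => by omega) hj
    unfold ch
    split_ifs with h3
    · rfl
    · rw [Nat.choose_eq_zero_of_lt (by omega)]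
      rfl

lemma coeff_formula (b : ℕ → ℕ) (r c i : ℕ)
    (hi : ∀ j, r + 1 ≤ j → j < r + c + 2 → i < b j + 1) :
    (hp (r + 1) (r + c + 2) (Mb b (r + 1) (r + c + 2))).coeff
      ((hp (r + 1) (r + c + 2) (Mb b (r + 1) (r + c + 2))).natDegree - i) =
    ∑ α ∈ Finset.range (c + 1 + 1), (-1 : ℤ) ^ α * ((r + c + 1 - α).choose r : ℤ) *
      ∑ J ∈ Finset.powersetCard α (Finset.univ : Finset (Fin (r + 1))),
        ch ((c : ℤ) + 1 + i - ((∑ j ∈ J, (b j + 1) : ℕ) : ℤ)) (c + 1) := by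
  have hd : (hp (r + 1) (r + c + 2) (Mb b (r + 1) (r + c + 2))).natDegree =
      ∑ j ∈ Finset.range (r + c + 2), b j + r := hp_natDegree b r (c + 1)
  obtain ⟨-, h2⟩ := main_formula b (r + c + 2) r (c + 1 + 1) (by omega)
  have hle : i ≤ ∑ j ∈ Finset.range (r + c + 2), b j + r := by
    have h1 := hi (r + 1) le_rfl (by omega)
    have h2 : b (r + 1) ≤ ∑ j ∈ Finset.range (r + c + 2), b j :=
      Finset.single_le_sum (fun _ _ => by omega) (Finset.mem_range.2 (by omega))
    omega
  rw [hd, ← revAt_le hle, ← coeff_reflect, ← LL_mul (c + 1), h2]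
  unfold FF
  rw [map_add, map_sum]
  have htop : LL (c + 1) i ((-1) ^ (c + 1 + 1) * es b (r + c + 2) (r + c + 2)) = 0 := by
    rw [show (-1 : ℤ[X]) ^ (c + 1 + 1) * es b (r + c + 2) (r + c + 2)
      = ((-1 : ℤ) ^ (c + 1 + 1)) • es b (r + c + 2) (r + c + 2) by
        rw [zsmul_eq_mul]; push_cast; rfl, map_zsmul,
      LL_es b (c + 1) i (r + 1) _ _ (by omega) hi,
      Finset.powersetCard_eq_empty.2 (by simp)]
    simp
  rw [htop, add_zero]
  refine Finset.sum_congr rfl fun α _ => ?_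
  rw [show (-1 : ℤ[X]) ^ α * (((r + (c + 1 + 1) - 1 - α).choose r : ℕ) : ℤ[X]) * es b α (r + c + 2)
      = ((-1 : ℤ) ^ α * ((r + c + 1 - α).choose r : ℤ)) • es b α (r + c + 2) by
        rw [zsmul_eq_mul, show r + (c + 1 + 1) - 1 - α = r + c + 1 - α by omega]; push_cast; rfl,
    map_zsmul, LL_es b (c + 1) i (r + 1) _ _ (by omega) hi, smul_eq_mul]
  push_cast
  rfl

/-- Last entries of the h-vector of a degree matrix with `r+1` equal rows and codimension
`c+2`: with `s = deg hp^A` and column degrees `a_1 ≤ ⋯ ≤ a_{r+c+2}` (the common row),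
for `0 ≤ i ≤ a_{r+2} - 1`,
`h_{s-i} = binom(r+c+1, c+1)·binom(c+1+i, c+1)
  + Σ_{α=1}^{c+1} (-1)^α binom(r+c+1-α, c+1-α) Σ_{j_1<⋯<j_α} binom(c+1+i-a_{j_1}-⋯-a_{j_α}, c+1)`,
the inner sum over `α`-subsets of the first `r+1` columns. -/
theorem hp_last_entries_equal_rows (r c : ℕ) (A : Matrix (Fin (r + 1)) (Fin (r + c + 2)) ℤ)
    (hA : IsDegreeMatrix A)
    (heq : ∀ (i i' : Fin (r + 1)) (j : Fin (r + c + 2)), A i j = A i' j)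
    (i : ℕ) (hi : (i : ℤ) ≤ A 0 ⟨r + 1, by omega⟩ - 1) :
    (hp (r + 1) (r + c + 2) A).coeff ((hp (r + 1) (r + c + 2) A).natDegree - i) =
      ((r + c + 1).choose (c + 1) : ℤ) * ((c + 1 + i).choose (c + 1) : ℤ) +
        ∑ α ∈ Finset.Icc 1 (c + 1),
          (-1 : ℤ) ^ α * ch ((r : ℤ) + c + 1 - α) (c + 1 - α) *
            ∑ J ∈ Finset.powersetCard α (Finset.univ : Finset (Fin (r + 1))),
              ch ((c : ℤ) + 1 + i - ∑ j ∈ J, A 0 (Fin.castLE (by omega) j)) (c + 1) := by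
  obtain ⟨-, hmono, -, hpos⟩ := hA
  have hpos' : ∀ j, 0 < A 0 j := fun j =>
    lt_of_lt_of_le (hpos 0 (by simp)) (hmono 0 _ _ (Fin.le_def.2 (by simp)))
  set b : ℕ → ℕ := fun j => if h : j < r + c + 2 then (A 0 ⟨j, h⟩ - 1).toNat else 0 with hb
  have hbA : ∀ (j : ℕ) (h : j < r + c + 2), A 0 ⟨j, h⟩ = ((b j + 1 : ℕ) : ℤ) := by
    intro j h
    have := hpos' ⟨j, h⟩
    simp only [hb, dif_pos h]
    omega
  have hAM : A = Mb b (r + 1) (r + c + 2) := by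
    funext x j
    rw [heq x 0 j]
    exact hbA j j.2
  have hi' : ∀ j, r + 1 ≤ j → j < r + c + 2 → i < b j + 1 := by
    intro j h1 h2
    have h3 := hmono 0 ⟨r + 1, by omega⟩ ⟨j, h2⟩ (Fin.le_def.2 h1)
    rw [hbA j h2] at h3
    omega
  have key := coeff_formula b r c i hi'
  rw [← hAM] at key
  rw [key, ← Finset.Ico_add_one_right_eq_Icc, Finset.range_eq_Ico,
    Finset.sum_eq_sum_Ico_succ_bot (by omega)]
  congr 1
  · have h1 : (r + c + 1).choose r = (r + c + 1).choose (c + 1) := by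
      rw [← Nat.choose_symm_of_eq_add (n := r + c + 1) (a := r) (b := c + 1) (by omega)]
    have h2 : ch ((c : ℤ) + 1 + i) (c + 1) = ((c + 1 + i).choose (c + 1) : ℤ) := by
      unfold ch
      rw [if_neg (by omega), show ((c : ℤ) + 1 + i).toNat = c + 1 + i by omega]
    simp [h1, h2]
  · refine Finset.sum_congr rfl fun α hα => ?_
    have hα' := Finset.mem_Ico.1 hα
    have h1 : ch ((r : ℤ) + c + 1 - α) (c + 1 - α) = ((r + c + 1 - α).choose r : ℤ) := by
      unfold ch
      rw [if_neg (by omega), show ((r : ℤ) + c + 1 - α).toNat = r + c + 1 - α by omega,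
        Nat.choose_symm_of_eq_add (n := r + c + 1 - α) (a := c + 1 - α) (b := r) (by omega)]
    rw [h1]
    congr 1
    refine Finset.sum_congr rfl fun J _ => ?_
    congr 2
    push_cast
    refine Finset.sum_congr rfl fun j _ => ?_
    have := hbA j (by omega)
    push_cast at this
    exact this.symm
end

section
/- Let A = (a_{i,j}) ∈ Z^{t×(t+c-1)} be a degree matrix with no zero entries, c ≥ 2, with r < t maximal equal rows, and suppose a_{r+1,1} > 0. Let h^A = (h_0,...,h_s). Then h_{s - a_{1,1} + a_{r+1,1}} > h_s · binom(c-1+a_{1,1}-a_{r+1,1}, c-1); consequently h^A is not a pure O-sequence. -/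
open Polynomial

namespace DetAux

/-- `1 + z + ⋯ + z^(n-1)` with natural-number argument. -/
noncomputable def g (n : ℕ) : Polynomial ℤ := ∑ i ∈ Finset.range n, Polynomial.X ^ i

lemma g_coeff (n i : ℕ) : (g n).coeff i = if i < n then 1 else 0 := by
  simp [g, Polynomial.coeff_X_pow]

/-- h-polynomial with `k+1` rows and codimension `e`. -/
noncomputable def F (a : ℕ → ℕ → ℕ) : ℕ → ℕ → Polynomial ℤ
  | _, 0 => 1
  | 0, e + 1 => g (a 0 e) * F a 0 e
  | k + 1, e + 1 => X ^ (a (k + 1) (k + 1 + e)) * F a k (e + 1)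
      + g (a (k + 1) (k + 1 + e)) * F a (k + 1) e
  termination_by k e => (k, e)

/-- expected degree -/
def S (a : ℕ → ℕ → ℕ) : ℕ → ℕ → ℕ
  | 0, e => ∑ j ∈ Finset.range e, (a 0 j - 1)
  | k + 1, e => a (k + 1) (k + e) + S a k e

/-- degree drop -/
def sh (a : ℕ → ℕ → ℕ) (k e : ℕ) : ℕ :=
  ∑ i ∈ Finset.range k, (a i (i + e) - a (i + 1) (i + e))

/-- reversed polynomial -/
noncomputable def R (a : ℕ → ℕ → ℕ) : ℕ → ℕ → Polynomial ℤ
  | k, 0 => X ^ (S a k 0)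
  | 0, e + 1 => g (a 0 e) * R a 0 e
  | k + 1, e + 1 => R a k (e + 1)
      + g (a (k + 1) (k + 1 + e)) * (X ^ (sh a (k + 1) e) * R a (k + 1) e)
  termination_by k e => (k, e)

lemma S_succ (a : ℕ → ℕ → ℕ) (hmono : ∀ i j, a (i + 1) j ≤ a i j)
    (hpos : ∀ i j, i ≤ j → 0 < a i j) (k e : ℕ) :
    S a k (e + 1) = (a k (k + e) - 1) + (sh a k e + S a k e) := by
  induction k with
  | zero => simp [S, sh, Finset.sum_range_succ, add_comm]
  | succ k ih =>
    have h1 := hmono k (k + e)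
    have h2 := hpos k (k + e) (by omega)
    have h3 := hpos (k + 1) (k + 1 + e) (by omega)
    have h4 : sh a (k + 1) e = sh a k e + (a k (k + e) - a (k + 1) (k + e)) := by
      simp [sh, Finset.sum_range_succ]
    rw [S, ih, h4, S, show k + (e + 1) = k + 1 + e by ring]
    omega

lemma g_natDegree (n : ℕ) : (g n).natDegree ≤ n - 1 := by
  rw [Polynomial.natDegree_le_iff_coeff_eq_zero]
  intro i hi
  rw [g_coeff, if_neg (by omega)]

lemma g_reflect (n : ℕ) (hn : 0 < n) : (g n).reflect (n - 1) = g n := by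
  ext i
  rw [Polynomial.coeff_reflect, g_coeff, g_coeff]
  rcases le_or_gt i (n - 1) with h | h
  · rw [Polynomial.revAt_le h, if_pos (by omega), if_pos (by omega)]
  · rw [Polynomial.revAt_eq_self_of_lt h]

lemma reflect_shift (p : Polynomial ℤ) (s N : ℕ) (h : p.natDegree ≤ N) :
    p.reflect (s + N) = X ^ s * p.reflect N := by
  have := Polynomial.reflect_mul (1 : Polynomial ℤ) p (F := s) (G := N) (by simp) h
  rwa [one_mul, Polynomial.reflect_one] at this

lemma F_spec (a : ℕ → ℕ → ℕ) (hmono : ∀ i j, a (i + 1) j ≤ a i j)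
    (hpos : ∀ i j, i ≤ j → 0 < a i j) (k e : ℕ) :
    (F a k e).natDegree ≤ S a k e ∧ (F a k e).reflect (S a k e) = R a k e := by
  induction k, e using F.induct with
  | case1 k => rw [F, R]; simp
  | case2 e ih =>
    obtain ⟨h1, h2⟩ := ih
    have hs : S a 0 (e + 1) = (a 0 e - 1) + S a 0 e := by
      simp [S, Finset.sum_range_succ, add_comm]
    rw [F, R, hs]
    refine ⟨Polynomial.natDegree_mul_le_of_le (g_natDegree _) h1, ?_⟩
    rw [Polynomial.reflect_mul _ _ (g_natDegree _) h1, h2, g_reflect _ (hpos _ _ (by omega))]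
  | case3 k e ih1 ih2 =>
    obtain ⟨h1, h2⟩ := ih1
    obtain ⟨h3, h4⟩ := ih2
    have e1 : S a (k + 1) (e + 1) = a (k + 1) (k + 1 + e) + S a k (e + 1) := by
      rw [S, show k + (e + 1) = k + 1 + e by ring]
    have e2 := S_succ a hmono hpos (k + 1) e
    have h5 : (F a (k + 1) e).natDegree ≤ sh a (k + 1) e + S a (k + 1) e := by omega
    rw [F, R]
    constructor
    · apply Polynomial.natDegree_add_le_of_degree_le
      · rw [e1]
        exact Polynomial.natDegree_mul_le_of_le (Polynomial.natDegree_X_pow_le _) h1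
      · rw [e2]
        exact Polynomial.natDegree_mul_le_of_le (g_natDegree _) h5
    · rw [Polynomial.reflect_add]
      congr 1
      · rw [e1, Polynomial.reflect_mul _ _ (Polynomial.natDegree_X_pow_le _) h1, h2]
        simp
      · rw [e2, Polynomial.reflect_mul _ _ (g_natDegree _) h5, g_reflect _ (hpos _ _ (by omega)),
          reflect_shift _ _ _ h3, h4]

/-- nonnegative coefficients -/
def NN (p : Polynomial ℤ) : Prop := ∀ i, 0 ≤ p.coeff i

lemma NN.add {p q : Polynomial ℤ} (hp : NN p) (hq : NN q) : NN (p + q) := fun i => by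
  rw [Polynomial.coeff_add]; exact add_nonneg (hp i) (hq i)

lemma NN.mul {p q : Polynomial ℤ} (hp : NN p) (hq : NN q) : NN (p * q) := fun i => by
  rw [Polynomial.coeff_mul]; exact Finset.sum_nonneg fun x _ => mul_nonneg (hp _) (hq _)

lemma NN_X (n : ℕ) : NN (X ^ n) := fun i => by
  rw [Polynomial.coeff_X_pow]; split_ifs <;> simp

lemma NN_g (n : ℕ) : NN (g n) := fun i => by
  rw [g_coeff]; split_ifs <;> simp

lemma NN_R (a : ℕ → ℕ → ℕ) (k e : ℕ) : NN (R a k e) := by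
  induction k, e using F.induct with
  | case1 k => rw [R]; exact NN_X _
  | case2 e ih => rw [R]; exact (NN_g _).mul ih
  | case3 k e ih1 ih2 => rw [R]; exact ih1.add ((NN_g _).mul ((NN_X _).mul ih2))

lemma NN_F (a : ℕ → ℕ → ℕ) (k e : ℕ) : NN (F a k e) := by
  induction k, e using F.induct with
  | case1 k => rw [F]; simpa using NN_X 0
  | case2 e ih => rw [F]; exact (NN_g _).mul ih
  | case3 k e ih1 ih2 => rw [F]; exact ((NN_X _).mul ih1).add ((NN_g _).mul ih2)

lemma g_mul_coeff_one (n : ℕ) (hn : 0 < n) (p : Polynomial ℤ) :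
    (g n * p).coeff 1 = p.coeff 1 + if 1 < n then p.coeff 0 else 0 := by
  rw [Polynomial.coeff_mul, Finset.Nat.antidiagonal_succ]
  simp [g_coeff, hn]

lemma F_low (a : ℕ → ℕ → ℕ) (hpos : ∀ i j, i ≤ j → 0 < a i j) (k e : ℕ) :
    (F a k e).coeff 0 ≤ 1 ∧ (F a k e).coeff 1 ≤ e := by
  induction k, e using F.induct with
  | case1 k => rw [F]; simp [Polynomial.coeff_one]
  | case2 e ih =>
    have hp := hpos 0 e (by omega)
    rw [F, g_mul_coeff_one _ hp, Polynomial.mul_coeff_zero, g_coeff, if_pos hp]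
    push_cast
    split_ifs <;> constructor <;> linarith [ih.1, ih.2]
  | case3 k e ih1 ih2 =>
    have hp := hpos (k + 1) (k + 1 + e) (by omega)
    rw [F, Polynomial.coeff_add, Polynomial.coeff_add, g_mul_coeff_one _ hp,
      Polynomial.mul_coeff_zero, Polynomial.mul_coeff_zero, g_coeff, if_pos hp,
      Polynomial.coeff_X_pow_mul', Polynomial.coeff_X_pow, if_neg (by omega)]
    push_cast
    obtain ⟨h1, h2⟩ := ih1
    obtain ⟨h3, h4⟩ := ih2
    refine ⟨by linarith, ?_⟩
    by_cases h : 1 < a (k + 1) (k + 1 + e)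
    · rw [if_neg (by omega), if_pos h]; linarith
    · rw [if_pos (by omega), if_neg h, show 1 - a (k + 1) (k + 1 + e) = 0 by omega]; linarith

lemma g_mul_coeff (n i : ℕ) (h : i < n) (p : Polynomial ℤ) :
    (g n * p).coeff i = ∑ u ∈ Finset.range (i + 1), p.coeff u := by
  rw [mul_comm, Polynomial.coeff_mul, Finset.Nat.sum_antidiagonal_eq_sum_range_succ_mk]
  apply Finset.sum_congr rfl
  intro u hu
  rw [g_coeff, if_pos (by omega), mul_one]

lemma sum_mc (e i : ℕ) :
    ∑ u ∈ Finset.range (i + 1), Nat.multichoose e u = Nat.multichoose (e + 1) i := by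
  induction i with
  | zero => simp
  | succ i ih => rw [Finset.sum_range_succ, ih, Nat.multichoose_succ_succ, add_comm]

lemma g_mul_lower (n d e : ℕ) (h : d < n) (p : Polynomial ℤ)
    (hp : ∀ i ≤ d, p.coeff 0 * (Nat.multichoose e i : ℤ) ≤ p.coeff i) :
    ∀ i ≤ d, (g n * p).coeff 0 * (Nat.multichoose (e + 1) i : ℤ) ≤ (g n * p).coeff i := by
  intro i hi
  rw [g_mul_coeff n 0 (by omega), g_mul_coeff n i (by omega), ← sum_mc]
  push_cast
  rw [Finset.mul_sum]
  simp only [zero_add, Finset.range_one, Finset.sum_singleton]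
  apply Finset.sum_le_sum
  intro u hu
  rw [Finset.mem_range] at hu
  exact hp u (by omega)

lemma R_one_le (a : ℕ → ℕ → ℕ) (hpos : ∀ i j, i ≤ j → 0 < a i j) (k e : ℕ) :
    1 ≤ (R a k (e + 1)).coeff 0 := by
  induction k with
  | zero =>
    have : ∀ e, (R a 0 e).coeff 0 = 1 := by
      intro e
      induction e with
      | zero => rw [R]; simp [S]
      | succ e ih =>
        rw [R, Polynomial.mul_coeff_zero, ih, g_coeff, if_pos (hpos _ _ (by omega)), mul_one]
    rw [this]
  | succ k ih =>
    rw [R, Polynomial.coeff_add]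
    have := ((NN_g (a (k + 1) (k + 1 + e))).mul ((NN_X (sh a (k + 1) e)).mul (NN_R a (k + 1) e))) 0
    linarith

lemma stage1 (a : ℕ → ℕ → ℕ) (r d : ℕ)
    (heq : ∀ i < r, ∀ j, a i j = a 0 j) (hd : ∀ j, d < a 0 j) (k e : ℕ) (hk : k < r) :
    ∀ i ≤ d, (R a k e).coeff 0 * (Nat.multichoose e i : ℤ) ≤ (R a k e).coeff i := by
  induction k, e using F.induct with
  | case1 k =>
    intro i hi
    cases i with
    | zero => simp
    | succ i => rw [Nat.multichoose_zero_succ]; simpa using NN_R a k 0 (i + 1)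
  | case2 e ih =>
    rw [R]
    exact g_mul_lower _ _ _ (hd _) _ (ih hk)
  | case3 k e ih1 ih2 =>
    have hsh : sh a (k + 1) e = 0 := by
      apply Finset.sum_eq_zero
      intro i hi
      rw [Finset.mem_range] at hi
      rw [heq i (by omega), heq (i + 1) (by omega), Nat.sub_self]
    intro i hi
    rw [R, hsh, pow_zero, one_mul, Polynomial.coeff_add, Polynomial.coeff_add, add_mul]
    refine add_le_add (ih1 (by omega) i hi) ?_
    refine g_mul_lower _ d e ?_ _ (ih2 hk) i hi
    rw [heq _ hk]; exact hd _

lemma sh_r (a : ℕ → ℕ → ℕ) (r d e : ℕ) (heq : ∀ i < r + 1, ∀ j, a i j = a 0 j)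
    (hd : ∀ j, a (r + 1) j + d = a 0 j) : sh a (r + 1) e = d := by
  rw [sh, Finset.sum_range_succ, Finset.sum_eq_zero, heq r (by omega)]
  · have := hd (r + e); omega
  · intro i hi
    rw [Finset.mem_range] at hi
    rw [heq i (by omega), heq (i + 1) (by omega), Nat.sub_self]

lemma stage3 (a : ℕ → ℕ → ℕ) (hpos : ∀ i j, i ≤ j → 0 < a i j) (r d : ℕ)
    (heq : ∀ i < r + 1, ∀ j, a i j = a 0 j) (hd : ∀ j, a (r + 1) j + d = a 0 j)
    (hrp : ∀ j, 0 < a (r + 1) j) (hd0 : 0 < d) (e n : ℕ) :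
    (R a (r + 1 + n) (e + 2)).coeff 0 * (Nat.multichoose (e + 2) d : ℤ) <
      (R a (r + 1 + n) (e + 2)).coeff d := by
  induction n with
  | zero =>
    have h1 := stage1 a (r + 1) d heq (fun j => by have := hd j; have := hrp j; omega) r (e + 2)
      (by omega) d le_rfl
    have hp := hpos (r + 1) (r + 1 + (e + 1)) (by omega)
    have h0 := R_one_le a hpos (r + 1) e
    rw [add_zero, R, sh_r a r d _ heq hd, Polynomial.coeff_add, Polynomial.coeff_add,
      mul_left_comm, Polynomial.coeff_X_pow_mul', Polynomial.coeff_X_pow_mul', if_neg (by omega),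
      if_pos le_rfl, Nat.sub_self, Polynomial.mul_coeff_zero, g_coeff, if_pos hp]
    linarith
  | succ n ih =>
    have hs : 0 < sh a (r + 1 + n + 1) (e + 1) := by
      have h1 := sh_r a r d (e + 1) heq hd
      have h2 : sh a (r + 1) (e + 1) ≤ sh a (r + 1 + n + 1) (e + 1) :=
        Finset.sum_le_sum_of_subset (Finset.range_mono (by omega))
      omega
    rw [← add_assoc, R, Polynomial.coeff_add, Polynomial.coeff_add]
    have h5 := ((NN_g (a (r + 1 + n + 1) (r + 1 + n + 1 + (e + 1)))).mul
      ((NN_X (sh a (r + 1 + n + 1) (e + 1))).mul (NN_R a (r + 1 + n + 1) (e + 1)))) d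
    rw [Polynomial.mul_coeff_zero, Polynomial.coeff_X_pow_mul', if_neg (by omega)]
    linarith

lemma F_main (a : ℕ → ℕ → ℕ) (hmono : ∀ i j, a (i + 1) j ≤ a i j)
    (hpos : ∀ i j, i ≤ j → 0 < a i j) (r d : ℕ)
    (heq : ∀ i < r + 1, ∀ j, a i j = a 0 j) (hd : ∀ j, a (r + 1) j + d = a 0 j)
    (hrp : ∀ j, 0 < a (r + 1) j) (hd0 : 0 < d) (e k : ℕ) (hk : r + 1 ≤ k) :
    d ≤ (F a k (e + 2)).natDegree ∧ F a k (e + 2) ≠ 0 ∧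
    (F a k (e + 2)).coeff (F a k (e + 2)).natDegree * (Nat.multichoose (e + 2) d : ℤ) <
      (F a k (e + 2)).coeff ((F a k (e + 2)).natDegree - d) := by
  obtain ⟨n, rfl⟩ := Nat.exists_eq_add_of_le hk
  have h3 := stage3 a hpos r d heq hd hrp hd0 e n
  obtain ⟨h1, h2⟩ := F_spec a hmono hpos (r + 1 + n) (e + 2)
  have h0 := R_one_le a hpos (r + 1 + n) (e + 1)
  have hd1 : (0:ℤ) < (R a (r + 1 + n) (e + 2)).coeff d := by
    refine lt_of_le_of_lt ?_ h3
    have : (0:ℤ) ≤ (R a (r + 1 + n) (e + 2)).coeff 0 := by linarith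
    positivity
  rw [← h2] at h3 h0 hd1
  rw [Polynomial.coeff_reflect] at h0 hd1
  rw [Polynomial.coeff_reflect, Polynomial.coeff_reflect] at h3
  rw [Polynomial.revAt_zero] at h3 h0
  have hdS : d ≤ S a (r + 1 + n) (e + 2) := by
    by_contra hcon
    rw [Polynomial.revAt_eq_self_of_lt (by omega),
      Polynomial.coeff_eq_zero_of_natDegree_lt (by omega)] at hd1
    exact lt_irrefl _ hd1
  have hN : (F a (r + 1 + n) (e + 2)).natDegree = S a (r + 1 + n) (e + 2) :=
    le_antisymm h1 (Polynomial.le_natDegree_of_ne_zero (by linarith))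
  rw [hN]
  rw [Polynomial.revAt_le hdS] at h3
  refine ⟨hdS, ?_, h3⟩
  intro h
  rw [h] at h0
  simp at h0

lemma hp_zero (m : ℕ) (B : Matrix (Fin 0) (Fin m) ℤ) : hp 0 m B = 0 := by
  rw [hp]

lemma hp_short (k : ℕ) (B : Matrix (Fin (k + 1)) (Fin k) ℤ) : hp (k + 1) k B = 1 := by
  cases k with
  | zero => rw [hp]
  | succ k => rw [hp, if_pos le_rfl]

lemma hp_step (t m : ℕ) (h : t ≤ m) (B : Matrix (Fin (t + 1)) (Fin (m + 1)) ℤ) :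
    hp (t + 1) (m + 1) B = X ^ (B (Fin.last t) (Fin.last m)).toNat *
          hp t m (fun i j => B i.castSucc j.castSucc) +
        geom (B (Fin.last t) (Fin.last m)) * hp (t + 1) m (fun i j => B i j.castSucc) := by
  rw [hp, if_neg (by omega)]

lemma hp_eq_F (a : ℕ → ℕ → ℕ) (k e : ℕ) : ∀ m, m = k + e →
    ∀ B : Matrix (Fin (k + 1)) (Fin m) ℤ, (∀ i j, (B i j).toNat = a i j) →
    hp (k + 1) m B = F a k e := by
  induction k, e using F.induct with
  | case1 k =>
    intro m hm B hB
    obtain rfl : k = m := by omega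
    rw [F, hp_short]
  | case2 e ih =>
    intro m hm B hB
    obtain rfl : m = e + 1 := by omega
    have h1 := ih e (by omega) (fun i j => B i j.castSucc) (fun i j => hB _ _)
    have h2 : (B (Fin.last 0) (Fin.last e)).toNat = a 0 e := by rw [hB]; simp
    have h3 := hp_zero e (fun i j => B i.castSucc j.castSucc)
    refine (hp_step 0 e (by omega) B).trans ?_
    rw [h3, F, mul_zero, zero_add, h1, geom, g, h2]
  | case3 k e ih1 ih2 =>
    intro m hm
    obtain rfl : m = (k + 1 + e) + 1 := by omega
    change ∀ B : Matrix (Fin (k + 1 + 1)) (Fin (k + 1 + e + 1)) ℤ, _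
    intro B hB
    have h1 := ih1 (k + 1 + e) (by omega) (fun i j => B i.castSucc j.castSucc) (fun i j => hB _ _)
    have h2 := ih2 (k + 1 + e) (by omega) (fun i j => B i j.castSucc) (fun i j => hB _ _)
    have h3 : (B (Fin.last (k + 1)) (Fin.last (k + 1 + e))).toNat = a (k + 1) (k + 1 + e) := by
      rw [hB]; simp
    refine (hp_step (k + 1) (k + 1 + e) (by omega) B).trans ?_
    rw [F, h1, h2, geom, g, h3]

lemma mc_mono (m n d : ℕ) (h : m ≤ n) : Nat.multichoose m d ≤ Nat.multichoose n d := by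
  rw [Nat.multichoose_eq, Nat.multichoose_eq]
  exact Nat.choose_le_choose _ (by omega)

lemma pure_bound (p : Polynomial ℤ) (hp0 : p ≠ 0) (hpure : IsPureOSequence fun i => p.coeff i)
    (n d : ℕ) (hn : p.coeff 1 ≤ n) (hd : d ≤ p.natDegree) :
    p.coeff (p.natDegree - d) ≤ p.coeff p.natDegree * (Nat.multichoose n d : ℤ) := by
  classical
  obtain ⟨N, Γ, hne, hdown, ⟨D, hD⟩, hcount'⟩ := hpure
  have hcount : ∀ i : ℕ, ((Γ.filter fun μ => ∑ j, μ j = i).card : ℤ) = p.coeff i := hcount'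
  have hmax : ∀ ν ∈ Γ, ∃ μ ∈ Γ, ν ≤ μ ∧ ∑ j, μ j = D := by
    intro ν hν
    obtain ⟨μ, hle, hμ⟩ := Γ.exists_le_maximal hν
    exact ⟨μ, hμ.1, hle, hD μ hμ.1 fun ξ hξ h => le_antisymm h (hμ.2 hξ h)⟩
  have hDs : p.natDegree = D := by
    apply le_antisymm
    · have h1 : p.coeff p.natDegree ≠ 0 := by simpa using hp0
      rw [← hcount p.natDegree] at h1
      have h2 : (Γ.filter fun μ => ∑ j, μ j = p.natDegree).Nonempty := by
        rw [← Finset.card_ne_zero]; exact_mod_cast h1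
      obtain ⟨ν, hν⟩ := h2
      rw [Finset.mem_filter] at hν
      obtain ⟨μ, _, hle, hs⟩ := hmax ν hν.1
      rw [← hν.2, ← hs]
      exact Finset.sum_le_sum fun j _ => hle j
    · apply Polynomial.le_natDegree_of_ne_zero
      rw [← hcount D]
      obtain ⟨ν, hν⟩ := hne
      obtain ⟨μ, hμ, _, hs⟩ := hmax ν hν
      have : (Γ.filter fun μ => ∑ j, μ j = D).card ≠ 0 := by
        rw [Finset.card_ne_zero]
        exact ⟨μ, Finset.mem_filter.2 ⟨hμ, hs⟩⟩
      exact_mod_cast this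
  rw [hDs] at hd ⊢
  let V : Finset (Fin N) := Finset.univ.filter fun j => Pi.single j 1 ∈ Γ
  have hV : V.card ≤ n := by
    have h1 : V.card ≤ (Γ.filter fun μ => ∑ j, μ j = 1).card := by
      apply Finset.card_le_card_of_injOn (fun j => Pi.single j 1)
      · intro j hj
        have hj' : Pi.single j 1 ∈ Γ := (Finset.mem_filter.1 hj).2
        exact Finset.mem_filter.2 ⟨hj', by simp⟩
      · intro j _ j' _ h
        by_contra hne
        have := congrFun h j
        simp [Pi.single_apply, hne] at this
    have h2 := hcount 1
    have : ((Γ.filter fun μ => ∑ j, μ j = 1).card : ℤ) ≤ n := by rw [h2]; exact hn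
    exact h1.trans (by exact_mod_cast this)
  have hsub : (Γ.filter fun μ => ∑ j, μ j = D - d) ⊆
      ((Γ.filter fun μ => ∑ j, μ j = D) ×ˢ V.finsuppAntidiag d).image
        (fun x => fun j => x.1 j - x.2 j) := by
    intro ν hν
    rw [Finset.mem_filter] at hν
    obtain ⟨μ, hμ, hle, hs⟩ := hmax ν hν.1
    rw [Finset.mem_image]
    have hsum : ∑ j, (μ j - ν j) = d := by
      have h1 : ∑ j, (μ j - ν j) + ∑ j, ν j = ∑ j, μ j := by
        rw [← Finset.sum_add_distrib]
        exact Finset.sum_congr rfl fun j _ => Nat.sub_add_cancel (hle j)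
      omega
    have hsupp : ∀ j, μ j - ν j ≠ 0 → j ∈ V := by
      intro j hj
      refine Finset.mem_filter.2 ⟨Finset.mem_univ _, hdown μ hμ _ ?_⟩
      intro i
      by_cases h : i = j
      · subst h; simp; omega
      · simp [Pi.single_apply, h]
    refine ⟨(μ, Finsupp.equivFunOnFinite.symm fun j => μ j - ν j), ?_, ?_⟩
    · rw [Finset.mem_product, Finset.mem_filter, Finset.mem_finsuppAntidiag]
      refine ⟨⟨hμ, hs⟩, ?_, ?_⟩
      · rw [← hsum]
        simp only [Finsupp.equivFunOnFinite_symm_apply_apply]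
        apply Finset.sum_subset (Finset.subset_univ _)
        intro j _ hj
        by_contra h
        exact hj (hsupp j h)
      · intro j hj
        apply hsupp
        simpa using hj
    · funext j
      have := show ν j ≤ μ j from hle j
      simp only [Finsupp.equivFunOnFinite_symm_apply_apply]
      omega
  have hcard := (Finset.card_le_card hsub).trans Finset.card_image_le
  rw [Finset.card_product, Finset.card_finsuppAntidiag_nat_eq_multichoose] at hcard
  have h3 := hcard.trans (Nat.mul_le_mul_left _ (mc_mono _ _ d hV))
  have e1 := hcount D
  have e2 := hcount (D - d)
  rw [← e1, ← e2]
  exact_mod_cast h3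

end DetAux

/-- Let `A ∈ ℤ^{(t+2)×(t+c+3)}` be a degree matrix (codimension `c+2 ≥ 2`) with no zero
entries, `r < t+2` maximal equal rows and `a_{r+1,1} > 0`. Then, writing
`h^A = (h_0,…,h_s)`, one has
`h_{s - a_{1,1} + a_{r+1,1}} > h_s · binom(c+1 + a_{1,1} - a_{r+1,1}, c+1)`;
consequently `h^A` is not a pure O-sequence. -/
theorem not_pure_of_pos_subdiagonal (t c r : ℕ)
    (A : Matrix (Fin (t + 2)) (Fin (t + c + 3)) ℤ)
    (hA : IsDegreeMatrix A) (hnz : ∀ i j, A i j ≠ 0)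
    (hr1 : 1 ≤ r) (hrt : r < t + 2)
    (hreq : ∀ i : Fin (t + 2), (i : ℕ) < r → A i 0 = A 0 0)
    (hrmax : A ⟨r, hrt⟩ 0 ≠ A 0 0)
    (hpos : 0 < A ⟨r, hrt⟩ 0) :
    (hp (t + 2) (t + c + 3) A).coeff
        ((hp (t + 2) (t + c + 3) A).natDegree - (A 0 0 - A ⟨r, hrt⟩ 0).toNat) >
      (hp (t + 2) (t + c + 3) A).coeff ((hp (t + 2) (t + c + 3) A).natDegree) *
        ch ((c : ℤ) + 1 + (A 0 0 - A ⟨r, hrt⟩ 0)) (c + 1) ∧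
    ¬ IsPureOSequence fun i => (hp (t + 2) (t + c + 3) A).coeff i := by
  obtain ⟨⟨α, β, hαβ⟩, hcol, hrow, hdiag⟩ := hA
  obtain ⟨r, rfl⟩ : ∃ r', r = r' + 1 := ⟨r - 1, by omega⟩
  set ρ : Fin (t + 2) := ⟨r + 1, hrt⟩ with hρ
  let fi : ℕ → Fin (t + 2) := fun i => ⟨min i (t + 1), by omega⟩
  let fj : ℕ → Fin (t + c + 3) := fun j => ⟨min j (t + c + 2), by omega⟩
  let a : ℕ → ℕ → ℕ := fun i j => (A (fi i) (fj j)).toNat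
  have hfr : fi (r + 1) = ρ := by
    apply Fin.ext; simp only [fi, hρ]; omega
  have hf0 : fi 0 = 0 := by
    apply Fin.ext; simp [fi]
  have hle0 : A ρ 0 ≤ A 0 0 := hrow 0 ρ 0 (Fin.zero_le _)
  have hlt0 : A ρ 0 < A 0 0 := lt_of_le_of_ne hle0 hrmax
  have hrp : ∀ j, 0 < A ρ j := fun j => lt_of_lt_of_le hpos (hcol ρ 0 j (Fin.zero_le _))
  obtain ⟨d, hd⟩ : ∃ d : ℕ, A 0 0 - A ρ 0 = d := ⟨(A 0 0 - A ρ 0).toNat, by omega⟩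
  have hmono : ∀ i j, a (i + 1) j ≤ a i j := by
    intro i j
    apply Int.toNat_le_toNat
    apply hrow
    simp only [fi, Fin.le_def]; omega
  have hpos' : ∀ i j, i ≤ j → 0 < a i j := by
    intro i j hij
    have h1 := hdiag (fi i) (by have := (fi i).2; omega)
    have h2 := hcol (fi i) ⟨fi i, by have := (fi i).2; omega⟩ (fj j) (by
      simp only [fi, fj, Fin.le_def]; omega)
    simp only [a]
    omega
  have heq : ∀ i < r + 1, ∀ j, a i j = a 0 j := by
    intro i hi j
    have h1 := hreq (fi i) (by simp only [fi]; omega)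
    simp only [a]
    rw [hf0]
    congr 1
    rw [hαβ, hαβ] at h1 ⊢
    linarith
  have hd' : ∀ j, a (r + 1) j + d = a 0 j := by
    intro j
    have h1 := hrp (fj j)
    have h2 : A 0 (fj j) - A ρ (fj j) = d := by
      rw [← hd, hαβ, hαβ, hαβ, hαβ]; ring
    simp only [a]
    rw [hf0, hfr]
    omega
  have hrp' : ∀ j, 0 < a (r + 1) j := by
    intro j
    have h1 := hrp (fj j)
    simp only [a]
    rw [hfr]
    omega
  have hF : hp (t + 2) (t + c + 3) A = DetAux.F a (t + 1) (c + 2) := by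
    apply DetAux.hp_eq_F a (t + 1) (c + 2) _ (by omega)
    intro i j
    simp only [a]
    congr 2
    · apply Fin.ext; simp only [fi]; omega
    · apply Fin.ext; simp only [fj]; omega
  obtain ⟨h1, h2, h3⟩ := DetAux.F_main a hmono hpos' r d heq hd' hrp' (by omega) c (t + 1)
    (by omega)
  have hch : ch ((c : ℤ) + 1 + (A 0 0 - A ρ 0)) (c + 1) = (Nat.multichoose (c + 2) d : ℤ) := by
    rw [hd, ch, if_neg (by omega), show ((c : ℤ) + 1 + d).toNat = c + 1 + d by omega,
      Nat.multichoose_eq, show c + 2 + d - 1 = c + 1 + d by omega]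
    exact_mod_cast Nat.choose_symm_add
  rw [hch, hd, Int.toNat_natCast, hF]
  refine ⟨h3, fun hpure => ?_⟩
  have h4 := DetAux.pure_bound _ h2 hpure (c + 2) d (DetAux.F_low a hpos' _ _).2 h1
  linarith
end

section
/- Let A = (a_{i,j}) ∈ Z^{t×(t+c-1)} be a degree matrix. Then hp^A(z) = Σ_{0 < i_1 < ... < i_{c-1} < t+c-1} z^{e_A(i_1,...,i_{c-1})} · hci_A(i_1,...,i_{c-1}), where for a sequence 0 < i_1 < ... < i_{c-1} < t+c-1 one defines {j_1,...,j_{i_{c-1}-(c-1)}} = {1,...,i_{c-1}} \ {i_1,...,i_{c-1}} (ordered), e_A(i_1,...,i_{c-1}) = Σ_{k=1}^{i_{c-1}-(c-1)} a_{k,j_k}, and hci_A(i_1,...,i_{c-1}) = ∏ over d in {a_{i_1,i_1}, a_{i_2-1,i_2}, ..., a_{i_{c-1}-(c-2),i_{c-1}}, Σ_{i=i_{c-1}-(c-2)}^t a_{i,i+c-1}} of (1+z+...+z^{d-1}). -/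
open Polynomial

namespace HPX

lemma hp_ss (t m : ℕ) (A : Matrix (Fin (t + 1)) (Fin (m + 1)) ℤ) :
    hp (t + 1) (m + 1) A = if m + 1 ≤ t then 1
    else
      Polynomial.X ^ (A (Fin.last t) (Fin.last m)).toNat *
          hp t m (fun i j => A i.castSucc j.castSucc) +
        geom (A (Fin.last t) (Fin.last m)) * hp (t + 1) m (fun i j => A i j.castSucc) := by
  rw [hp.eq_def]

lemma hp_s0 (t : ℕ) (A : Matrix (Fin (t + 1)) (Fin 0) ℤ) : hp (t + 1) 0 A = 1 := by
  rw [hp.eq_def]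

lemma hp_0 (m : ℕ) (A : Matrix (Fin 0) (Fin m) ℤ) : hp 0 m A = 0 := by
  rw [hp.eq_def]

noncomputable def hpE (a : ℕ → ℕ → ℤ) (t m : ℕ) : Polynomial ℤ :=
  hp t m (fun i j => a ((i : ℕ) + 1) ((j : ℕ) + 1))

/-- Weighted path sums. -/
noncomputable def W (a : ℕ → ℕ → ℤ) : ℕ → ℕ → Polynomial ℤ
  | 0, 0 => 1
  | 0, _ + 1 => 0
  | n + 1, 0 => X ^ (a (n + 1) (n + 1)).toNat * W a n 0
  | n + 1, k + 1 => W a n k * geom (a (n + 1 - k) (n + 1)) +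
      X ^ (a (n - k) (n + 1)).toNat * W a n (k + 1)

noncomputable def H (a : ℕ → ℕ → ℤ) (t c : ℕ) : Polynomial ℤ :=
  ∑ s ∈ Finset.range t, W a (c + s) c * geom (a (s + 1) (c + s + 1))

lemma W_eq_zero (a : ℕ → ℕ → ℤ) (n k : ℕ) (h : n < k) : W a n k = 0 := by
  induction n generalizing k with
  | zero =>
    cases k with
    | zero => omega
    | succ k => rw [W]
  | succ n ih =>
    cases k with
    | zero => omega
    | succ k => rw [W, ih k (by omega), ih (k + 1) (by omega)]; simp

lemma geom_mul (d : ℤ) : (1 - X) * geom d = 1 - X ^ d.toNat := by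
  unfold geom
  exact mul_neg_geom_sum X d.toNat

lemma geom_add (x y : ℤ) (hx : 0 ≤ x) (hy : 0 ≤ y) :
    geom (x + y) = X ^ y.toNat * geom x + geom y := by
  unfold geom
  rw [Int.toNat_add hx hy, add_comm, Finset.sum_range_add, Finset.mul_sum, add_comm]
  simp [pow_add]

lemma geom_zero : geom 0 = 0 := by simp [geom]

lemma W_diag (a : ℕ → ℕ → ℤ) (c : ℕ) :
    W a (c + 1) (c + 1) = W a c c * geom (a 1 (c + 1)) := by
  rw [W, W_eq_zero a c (c + 1) (by omega)]
  simp

lemma K_zero (a : ℕ → ℕ → ℤ) (t : ℕ) : W a t 0 + (1 - X) * H a t 0 = 1 := by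
  induction t with
  | zero => simp [W, H]
  | succ t ih =>
    have e : H a (t + 1) 0 = H a t 0 + W a t 0 * geom (a (t + 1) (t + 1)) := by
      simp [H, Finset.sum_range_succ]
    rw [e, W]
    have := geom_mul (a (t + 1) (t + 1))
    linear_combination ih + W a t 0 * this

lemma H_succ (a : ℕ → ℕ → ℤ) (t c : ℕ) :
    H a (t + 1) c = H a t c + W a (c + t) c * geom (a (t + 1) (c + t + 1)) := by
  simp [H, Finset.sum_range_succ]

lemma K_succ (a : ℕ → ℕ → ℤ) (t c : ℕ) :
    W a (c + 1 + t) (c + 1) + (1 - X) * H a t (c + 1) = H a (t + 1) c := by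
  induction t with
  | zero => simp [H, W_diag]
  | succ t ih =>
    rw [H_succ a (t + 1) c, H_succ a t (c + 1), ← ih]
    have e : W a (c + 1 + (t + 1)) (c + 1) =
        W a (c + (t + 1)) c * geom (a (t + 1 + 1) (c + (t + 1) + 1)) +
        X ^ (a (t + 1) (c + 1 + t + 1)).toNat * W a (c + 1 + t) (c + 1) := by
      rw [show c + 1 + (t + 1) = (c + (t + 1)) + 1 by ring, W]
      rw [show c + (t + 1) + 1 - c = t + 1 + 1 by omega, show c + (t + 1) - c = t + 1 by omega,
        show c + 1 + t = c + (t + 1) by ring]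
    rw [e]
    have := geom_mul (a (t + 1) (c + 1 + t + 1))
    linear_combination W a (c + 1 + t) (c + 1) * this

lemma hpE_succ (a : ℕ → ℕ → ℤ) (t m : ℕ) (h : t ≤ m) :
    hpE a (t + 1) (m + 1) = X ^ (a (t + 1) (m + 1)).toNat * hpE a t m +
      geom (a (t + 1) (m + 1)) * hpE a (t + 1) m := by
  exact (hp_ss t m _).trans (if_neg (by omega))

lemma hpE_one (a : ℕ → ℕ → ℤ) (t : ℕ) : hpE a (t + 1) t = 1 := by
  cases t with
  | zero => exact hp_s0 _ _
  | succ t => exact (hp_ss _ _ _).trans (if_pos le_rfl)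

lemma hpE_zero (a : ℕ → ℕ → ℤ) (m : ℕ) : hpE a 0 m = 0 := by
  exact hp_0 _ _

lemma hpE_eq_H (a : ℕ → ℕ → ℤ) (c t : ℕ) : hpE a t (c + t) = H a t c := by
  induction c generalizing t with
  | zero =>
    induction t with
    | zero => simp [hpE_zero, H]
    | succ t ih =>
      rw [← add_assoc, hpE_succ _ _ _ (by omega), ih, zero_add, hpE_one, H_succ]
      have := geom_mul (a (t + 1) (t + 1))
      have k := K_zero a t
      simp only [zero_add]
      linear_combination (H a t 0) * this - geom (a (t + 1) (t + 1)) * k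
  | succ c ihc =>
    induction t with
    | zero => simp [hpE_zero, H]
    | succ t ih =>
      rw [← add_assoc, hpE_succ _ _ _ (by omega), ih,
        show c + 1 + t = c + (t + 1) by ring, ihc, H_succ a t (c + 1), ← K_succ,
        show c + 1 + t = c + (t + 1) by ring]
      have := geom_mul (a (t + 1) (c + (t + 1) + 1))
      linear_combination (H a t (c + 1)) * this

/-- Closed form grouped by the largest index. -/
noncomputable def F (a : ℕ → ℕ → ℤ) (t c : ℕ) : Polynomial ℤ :=
  ∑ s ∈ Finset.range t, W a (c + s) c * geom (a (s + 1) (c + s + 1)) *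
    geom (∑ i ∈ Finset.Icc (s + 1) t, a i (i + (c + 1)))

lemma F_succ (a : ℕ → ℕ → ℤ) (hb : ∀ i j, i ≤ j → 0 ≤ a i j) (t c : ℕ) :
    F a (t + 1) c = X ^ (a (t + 1) (t + 1 + (c + 1))).toNat * F a t c +
      geom (a (t + 1) (t + 1 + (c + 1))) * H a (t + 1) c := by
  have e : ∀ s ∈ Finset.range (t + 1),
      W a (c + s) c * geom (a (s + 1) (c + s + 1)) *
        geom (∑ i ∈ Finset.Icc (s + 1) (t + 1), a i (i + (c + 1))) =
      X ^ (a (t + 1) (t + 1 + (c + 1))).toNat * (W a (c + s) c * geom (a (s + 1) (c + s + 1)) *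
        geom (∑ i ∈ Finset.Icc (s + 1) t, a i (i + (c + 1)))) +
      geom (a (t + 1) (t + 1 + (c + 1))) * (W a (c + s) c * geom (a (s + 1) (c + s + 1))) := by
    intro s hs
    rw [Finset.mem_range] at hs
    rw [Finset.sum_Icc_succ_top (by omega), geom_add _ _
      (Finset.sum_nonneg fun i _ => hb _ _ (by omega)) (hb _ _ (by omega))]
    ring
  rw [F, Finset.sum_congr rfl e, Finset.sum_add_distrib, ← Finset.mul_sum, ← Finset.mul_sum,
    Finset.sum_range_succ]
  simp [F, H, geom_zero]

lemma hpE_eq_F (a : ℕ → ℕ → ℤ) (hb : ∀ i j, i ≤ j → 0 ≤ a i j) (t c : ℕ) :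
    hpE a t (c + 1 + t) = F a t c := by
  induction t with
  | zero => simp [hpE_zero, F]
  | succ t ih =>
    rw [← add_assoc, hpE_succ _ _ _ (by omega), ih, F_succ a hb,
        show c + 1 + t = c + (t + 1) by ring, hpE_eq_H,
        show c + (t + 1) + 1 = t + 1 + (c + 1) by ring]

lemma hpE_codim_one (a : ℕ → ℕ → ℤ) (hb : ∀ i j, i ≤ j → 0 ≤ a i j) (t : ℕ) :
    hpE a t t = geom (∑ i ∈ Finset.Icc 1 t, a i i) := by
  induction t with
  | zero => simp [hpE_zero, geom_zero]
  | succ t ih =>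
    rw [hpE_succ _ _ _ (by omega), ih, Finset.sum_Icc_succ_top (by omega), geom_add _ _
      (Finset.sum_nonneg fun i _ => hb _ _ (by omega)) (hb _ _ (by omega)), hpE_one, mul_one]

open scoped Classical in
/-- Sum over strictly increasing sequences. -/
noncomputable def T (n c : ℕ) (f : (Fin c → ℕ) → Polynomial ℤ) : Polynomial ℤ :=
  ∑ ι ∈ Finset.univ.filter (fun ι : Fin c → Fin n => StrictMono ι), f (fun k => (ι k : ℕ))

def P (n c : ℕ) (ι : Fin c → ℕ) : Prop := StrictMono ι ∧ ∀ k, ι k < n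

lemma T_congr (n c : ℕ) (f g : (Fin c → ℕ) → Polynomial ℤ) (h : ∀ ι, P n c ι → f ι = g ι) :
    T n c f = T n c g := by
  unfold T
  refine Finset.sum_congr rfl fun ι hι => h _ ⟨?_, fun k => (ι k).2⟩
  simp only [Finset.mem_filter, Finset.mem_univ, true_and] at hι
  exact fun x y hxy => hι hxy

lemma T_zero (n : ℕ) (f : (Fin 0 → ℕ) → Polynomial ℤ) : T n 0 f = f Fin.elim0 := by
  unfold T
  rw [Finset.filter_true_of_mem (p := fun ι : Fin 0 → Fin n => StrictMono ι)
    (fun ι _ => fun x => x.elim0)]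
  simp only [Finset.univ_unique, Finset.sum_singleton]
  congr 1
  exact Subsingleton.elim _ _

lemma T_empty (c : ℕ) (f : (Fin (c + 1) → ℕ) → Polynomial ℤ) : T 0 (c + 1) f = 0 := by
  unfold T
  simp

lemma T_succ (n c : ℕ) (f : (Fin (c + 1) → ℕ) → Polynomial ℤ) :
    T (n + 1) (c + 1) f = T n c (fun ι => f (Fin.snoc (α := fun _ => ℕ) ι n)) + T n (c + 1) f := by
  classical
  unfold T
  rw [← Finset.sum_filter_add_sum_filter_not _
    (fun ι : Fin (c + 1) → Fin (n + 1) => ι (Fin.last c) = Fin.last n)]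
  congr 1
  · symm
    refine Finset.sum_bij (fun ι _ => Fin.snoc (α := fun _ => Fin (n + 1))
      (fun k => (ι k).castSucc) (Fin.last n)) ?_ ?_ ?_ ?_
    · intro ι hι
      simp only [Finset.mem_filter, Finset.mem_univ, true_and] at hι ⊢
      refine ⟨?_, by simp⟩
      intro x y hxy
      induction y using Fin.lastCases with
      | last =>
        induction x using Fin.lastCases with
        | last => exact absurd hxy (lt_irrefl _)
        | cast x => simp [Fin.castSucc_lt_last]
      | cast y =>
        induction x using Fin.lastCases with
        | last => exact absurd hxy (not_lt.2 (Fin.le_last _))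
        | cast x => simpa using hι (by simpa using hxy)
    · intro ι _ κ _ h
      funext k
      have := congrFun h k.castSucc
      simpa using this
    · intro ι hι
      simp only [Finset.mem_filter, Finset.mem_univ, true_and] at hι
      have hlt : ∀ k : Fin c, (ι k.castSucc : ℕ) < n := by
        intro k
        have := hι.1 (Fin.castSucc_lt_last k)
        rw [hι.2] at this
        exact this
      refine ⟨fun k => ⟨ι k.castSucc, hlt k⟩, ?_, ?_⟩
      · simp only [Finset.mem_filter, Finset.mem_univ, true_and]
        intro x y hxy
        have := hι.1 (show x.castSucc < y.castSucc from hxy)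
        exact this
      · funext k
        induction k using Fin.lastCases with
        | last => simp [hι.2]
        | cast k => simp
    · intro ι _
      refine congrArg f ?_
      funext k
      induction k using Fin.lastCases with
      | last => simp
      | cast k => simp
  · symm
    refine Finset.sum_bij (fun ι _ => fun k => (ι k).castSucc) ?_ ?_ ?_ ?_
    · intro ι hι
      simp only [Finset.mem_filter, Finset.mem_univ, true_and] at hι ⊢
      exact ⟨fun x y hxy => hι hxy, (Fin.castSucc_lt_last _).ne⟩
    · intro ι _ κ _ h
      funext k
      have := congrFun h k
      simpa using this
    · intro ι hι
      simp only [Finset.mem_filter, Finset.mem_univ, true_and] at hι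
      have hlt : ∀ k, (ι k : ℕ) < n := by
        intro k
        have h1 : (ι k : ℕ) ≤ ι (Fin.last c) := hι.1.monotone (Fin.le_last k)
        have h2 : (ι (Fin.last c) : ℕ) ≠ n := fun h => hι.2 (Fin.ext h)
        have := (ι (Fin.last c)).2
        omega
      refine ⟨fun k => ⟨ι k, hlt k⟩, ?_, ?_⟩
      · simp only [Finset.mem_filter, Finset.mem_univ, true_and]
        exact fun x y hxy => hι.1 hxy
      · funext k
        simp
    · intro ι _
      rfl

lemma T_last (n c : ℕ) (f : (Fin (c + 1) → ℕ) → Polynomial ℤ) :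
    T n (c + 1) f =
      ∑ l ∈ Finset.range n, T l c (fun ι => f (Fin.snoc (α := fun _ => ℕ) ι l)) := by
  induction n with
  | zero => simp [T_empty]
  | succ n ih => rw [T_succ, ih, Finset.sum_range_succ, add_comm]

def J {c : ℕ} (n : ℕ) (ι : Fin c → ℕ) : List ℕ :=
  (List.range' 1 n).filter fun j => ∀ k, ι k + 1 ≠ j

def ex (a : ℕ → ℕ → ℤ) {c : ℕ} (n : ℕ) (ι : Fin c → ℕ) : ℤ :=
  ∑ p ∈ Finset.range (J n ι).length, a (p + 1) ((J n ι).getD p 0)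

lemma J_succ {c : ℕ} (n : ℕ) (ι : Fin c → ℕ) (h : ∀ k, ι k ≠ n) :
    J (n + 1) ι = J n ι ++ [n + 1] := by
  unfold J
  rw [List.range'_1_concat, List.filter_append]
  congr 1
  simp [h, add_comm]

lemma J_snoc {c : ℕ} (n : ℕ) (ι : Fin c → ℕ) :
    J (n + 1) (Fin.snoc (α := fun _ => ℕ) ι n : Fin (c + 1) → ℕ) = J n ι := by
  unfold J
  rw [List.range'_1_concat, List.filter_append]
  have h : List.filter (fun j => decide (∀ k, (Fin.snoc (α := fun _ => ℕ) ι n : Fin (c + 1) → ℕ) k + 1 ≠ j)) [1 + n] = [] := by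
    simp only [List.filter_eq_nil_iff, List.mem_singleton, decide_eq_true_eq]
    rintro j rfl h
    exact h (Fin.last c) (by simp [add_comm])
  rw [h, List.append_nil]
  apply List.filter_congr
  intro j hj
  rw [List.mem_range'_1] at hj
  simp only [decide_eq_decide]
  constructor
  · intro h k
    simpa using h k.castSucc
  · intro h k
    induction k using Fin.lastCases with
    | last => simp; omega
    | cast k => simpa using h k

lemma ex_snoc (a : ℕ → ℕ → ℤ) {c : ℕ} (n : ℕ) (ι : Fin c → ℕ) :
    ex a (n + 1) (Fin.snoc (α := fun _ => ℕ) ι n : Fin (c + 1) → ℕ) = ex a n ι := by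
  unfold ex
  rw [J_snoc]

lemma ex_succ' (a : ℕ → ℕ → ℤ) {c : ℕ} (n : ℕ) (ι : Fin c → ℕ) (h : ∀ k, ι k ≠ n) :
    ex a (n + 1) ι = ex a n ι + a ((J n ι).length + 1) (n + 1) := by
  unfold ex
  rw [J_succ n ι h, List.length_append, List.length_singleton, Finset.sum_range_succ]
  congr 1
  · refine Finset.sum_congr rfl fun p hp => ?_
    rw [List.getD_append _ _ _ _ (Finset.mem_range.1 hp)]
  · rw [List.getD_append_right _ _ _ _ le_rfl]
    simp

lemma P_cases (n c : ℕ) (ι : Fin (c + 1) → ℕ) (h : P (n + 1) (c + 1) ι) :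
    P n (c + 1) ι ∨ ∃ κ, P n c κ ∧ ι = Fin.snoc (α := fun _ => ℕ) κ n := by
  by_cases hl : ι (Fin.last c) = n
  · right
    refine ⟨fun k => ι k.castSucc, ⟨fun x y hxy => h.1 (by simpa using hxy), fun k => ?_⟩, ?_⟩
    · have := h.1 (Fin.castSucc_lt_last k)
      rw [hl] at this
      exact this
    · funext k
      induction k using Fin.lastCases with
      | last => simp [hl]
      | cast k => simp
  · left
    refine ⟨h.1, fun k => ?_⟩
    have h1 : ι k ≤ ι (Fin.last c) := h.1.monotone (Fin.le_last k)
    have := h.2 (Fin.last c)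
    omega

lemma J_length (n c : ℕ) (ι : Fin c → ℕ) (h : P n c ι) : (J n ι).length + c = n := by
  induction n generalizing c with
  | zero =>
    cases c with
    | zero => simp [J]
    | succ c => exact absurd (h.2 0) (by omega)
  | succ n ih =>
    cases c with
    | zero =>
      rw [J_succ n ι (fun k => k.elim0)]
      have := ih 0 ι ⟨h.1, fun k => k.elim0⟩
      simp; omega
    | succ c =>
      rcases P_cases n c ι h with h' | ⟨κ, hκ, rfl⟩
      · rw [J_succ n ι (fun k => (h'.2 k).ne)]
        have := ih _ ι h'
        simp; omega
      · rw [J_snoc]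
        have := ih _ κ hκ
        omega

lemma ex_succ (a : ℕ → ℕ → ℤ) {c : ℕ} (n : ℕ) (ι : Fin c → ℕ) (h : P n c ι) :
    ex a (n + 1) ι = ex a n ι + a (n - c + 1) (n + 1) := by
  rw [ex_succ' a n ι (fun k => (h.2 k).ne)]
  have := J_length n c ι h
  rw [show (J n ι).length = n - c by omega]

lemma ex_nonneg (a : ℕ → ℕ → ℤ) (hb : ∀ i j, i ≤ j → 0 ≤ a i j) (n c : ℕ) (ι : Fin c → ℕ)
    (h : P n c ι) : 0 ≤ ex a n ι := by
  induction n generalizing c with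
  | zero => simp [ex, J]
  | succ n ih =>
    cases c with
    | zero =>
      have h' : P n 0 ι := ⟨h.1, fun k => k.elim0⟩
      rw [ex_succ a n ι h']
      exact add_nonneg (ih _ _ h') (hb _ _ (by omega))
    | succ c =>
      rcases P_cases n c ι h with h' | ⟨κ, hκ, rfl⟩
      · rw [ex_succ a n ι h']
        exact add_nonneg (ih _ _ h') (hb _ _ (by omega))
      · rw [ex_snoc]
        exact ih _ _ hκ

lemma P_le (n c : ℕ) (ι : Fin c → ℕ) (h : P n c ι) : c ≤ n := by
  have := J_length n c ι h
  omega

noncomputable def w (a : ℕ → ℕ → ℤ) (n c : ℕ) (ι : Fin c → ℕ) : Polynomial ℤ :=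
  X ^ (ex a n ι).toNat * ∏ k : Fin c, geom (a (ι k + 1 - (k : ℕ)) (ι k + 1))

lemma w_snoc (a : ℕ → ℕ → ℤ) (n c : ℕ) (ι : Fin c → ℕ) :
    w a (n + 1) (c + 1) (Fin.snoc (α := fun _ => ℕ) ι n) =
      w a n c ι * geom (a (n + 1 - c) (n + 1)) := by
  unfold w
  rw [ex_snoc, Fin.prod_univ_castSucc]
  simp [mul_assoc]

lemma w_succ (a : ℕ → ℕ → ℤ) (hb : ∀ i j, i ≤ j → 0 ≤ a i j) (n c : ℕ) (ι : Fin c → ℕ)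
    (h : P n c ι) :
    w a (n + 1) c ι = X ^ (a (n - c + 1) (n + 1)).toNat * w a n c ι := by
  unfold w
  rw [ex_succ a n ι h, Int.toNat_add (ex_nonneg a hb n c ι h) (hb _ _ (by omega)), pow_add]
  ring

lemma T_mul_left (n c : ℕ) (p : Polynomial ℤ) (f : (Fin c → ℕ) → Polynomial ℤ) :
    T n c (fun ι => p * f ι) = p * T n c f := by
  unfold T
  rw [Finset.mul_sum]

lemma T_mul_right (n c : ℕ) (p : Polynomial ℤ) (f : (Fin c → ℕ) → Polynomial ℤ) :
    T n c (fun ι => f ι * p) = T n c f * p := by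
  unfold T
  rw [Finset.sum_mul]

lemma T_w (a : ℕ → ℕ → ℤ) (hb : ∀ i j, i ≤ j → 0 ≤ a i j) (n c : ℕ) :
    T n c (w a n c) = W a n c := by
  induction n generalizing c with
  | zero =>
    cases c with
    | zero => simp [T_zero, w, W, ex, J]
    | succ c => rw [T_empty, W]
  | succ n ih =>
    cases c with
    | zero =>
      rw [W, ← ih, T_zero, T_zero, w_succ a hb n 0 _ ⟨fun x => x.elim0, fun x => x.elim0⟩]
      simp
    | succ c =>
      rw [T_succ, W, ← ih, ← ih]
      congr 1
      · simp_rw [w_snoc]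
        rw [T_mul_right]
      · rw [← T_mul_left]
        apply T_congr
        intro ι h
        have := P_le _ _ _ h
        rw [w_succ a hb _ _ _ h, show n - (c + 1) + 1 = n - c by omega]

noncomputable def term (a : ℕ → ℕ → ℤ) (t c : ℕ) (ι : Fin c → ℕ) : Polynomial ℤ :=
  X ^ (ex a (Finset.univ.sup fun k => ι k + 1) ι).toNat *
    ((∏ k : Fin c, geom (a (ι k + 1 - (k : ℕ)) (ι k + 1))) *
      geom (∑ i ∈ Finset.Icc (max 1 ((Finset.univ.sup fun k => ι k + 1) - (c - 1))) (t + 1),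
        a i (i + c)))

lemma sup_snoc (l c : ℕ) (ι : Fin c → ℕ) (h : P l c ι) :
    (Finset.univ.sup fun k => (Fin.snoc (α := fun _ => ℕ) ι l : Fin (c + 1) → ℕ) k + 1) = l + 1 := by
  apply le_antisymm
  · apply Finset.sup_le
    intro k _
    induction k using Fin.lastCases with
    | last => simp
    | cast k => simpa using (h.2 k).le
  · have := Finset.le_sup (f := fun k => (Fin.snoc (α := fun _ => ℕ) ι l : Fin (c + 1) → ℕ) k + 1)
      (Finset.mem_univ (Fin.last c))
    simpa using this

lemma term_snoc (a : ℕ → ℕ → ℤ) (t c l : ℕ) (ι : Fin c → ℕ) (h : P l c ι) :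
    term a t (c + 1) (Fin.snoc (α := fun _ => ℕ) ι l) =
      w a l c ι * (geom (a (l + 1 - c) (l + 1)) *
        geom (∑ i ∈ Finset.Icc (l + 1 - c) (t + 1), a i (i + (c + 1)))) := by
  have hle := P_le _ _ _ h
  have e := w_snoc a l c ι
  unfold term
  rw [sup_snoc l c ι h, ← mul_assoc, ← mul_assoc, ← e, w,
    show max 1 (l + 1 - (c + 1 - 1)) = l + 1 - c by omega]

lemma T_term_succ (a : ℕ → ℕ → ℤ) (hb : ∀ i j, i ≤ j → 0 ≤ a i j) (t c : ℕ) :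
    T (t + (c + 1)) (c + 1) (term a t (c + 1)) = F a (t + 1) c := by
  rw [T_last]
  have e : ∀ l ∈ Finset.range (t + (c + 1)),
      T l c (fun ι => term a t (c + 1) (Fin.snoc (α := fun _ => ℕ) ι l)) =
      W a l c * (geom (a (l + 1 - c) (l + 1)) *
        geom (∑ i ∈ Finset.Icc (l + 1 - c) (t + 1), a i (i + (c + 1)))) := by
    intro l _
    rw [T_congr _ _ _ _ (fun ι h => term_snoc a t c l ι h), T_mul_right, T_w a hb]
  rw [Finset.sum_congr rfl e, show t + (c + 1) = c + (t + 1) by ring, Finset.sum_range_add,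
    Finset.sum_eq_zero, zero_add]
  · unfold F
    refine Finset.sum_congr rfl fun s _ => ?_
    rw [show c + s + 1 - c = s + 1 by omega, mul_assoc]
  · intro l hl
    rw [W_eq_zero a l c (Finset.mem_range.1 hl), zero_mul]

lemma T_term (a : ℕ → ℕ → ℤ) (hb : ∀ i j, i ≤ j → 0 ≤ a i j) (t c : ℕ) :
    hpE a (t + 1) (t + c + 1) = T (t + c) c (term a t c) := by
  cases c with
  | zero =>
    rw [T_zero, add_zero, hpE_codim_one a hb]
    simp [term, ex, J]
  | succ c =>
    rw [T_term_succ a hb, ← hpE_eq_F a hb]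
    congr 1
    ring

end HPX

open scoped Classical in
/-- Explicit formula for the h-polynomial of a degree matrix `A ∈ ℤ^{(t+1)×(t+c+1)}`
(codimension `c+1`):
`hp^A(z) = Σ_{0 < i_1 < ⋯ < i_c < t+c+1} z^{e_A(i_1,…,i_c)} · hci_A(i_1,…,i_c)`,
where (working with 1-based indices, `aE` extending `A` by zero) for a strictly increasing
sequence `ι` with values `v k = ι k + 1` in `{1,…,t+c}` and maximum `M`:
the ordered complement `J = {1,…,M} \ {v k}` gives `e_A = Σ_k a_{k, J_k}`, and
`hci_A` is the product of `1+z+⋯+z^{d-1}` for `d` in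
`{a_{i_1,i_1}, a_{i_2-1,i_2}, …, a_{i_c-(c-1),i_c}, Σ_{i=i_c-(c-1)}^{t+1} a_{i,i+c}}`. -/
theorem hp_explicit_formula (t c : ℕ) (A : Matrix (Fin (t + 1)) (Fin (t + c + 1)) ℤ)
    (hA : IsDegreeMatrix A) :
    hp (t + 1) (t + c + 1) A =
      ∑ ι ∈ Finset.univ.filter (fun ι : Fin c → Fin (t + c) => StrictMono ι),
        (let v : Fin c → ℕ := fun k => (ι k : ℕ) + 1
         let M : ℕ := Finset.univ.sup v
         let aE : ℕ → ℕ → ℤ := fun i j =>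
           if h : 1 ≤ i ∧ i - 1 < t + 1 ∧ 1 ≤ j ∧ j - 1 < t + c + 1 then
             A ⟨i - 1, h.2.1⟩ ⟨j - 1, h.2.2.2⟩ else 0
         let J : List ℕ := (List.range' 1 M).filter fun j => ∀ k, v k ≠ j
         Polynomial.X ^ (∑ p ∈ Finset.range J.length, aE (p + 1) (J.getD p 0)).toNat *
           ((∏ k : Fin c, geom (aE (v k - (k : ℕ)) (v k))) *
             geom (∑ i ∈ Finset.Icc (max 1 (M - (c - 1))) (t + 1), aE i (i + c)))) := by
  classical
  set a : ℕ → ℕ → ℤ := fun i j =>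
    if h : 1 ≤ i ∧ i - 1 < t + 1 ∧ 1 ≤ j ∧ j - 1 < t + c + 1 then
      A ⟨i - 1, h.2.1⟩ ⟨j - 1, h.2.2.2⟩ else 0 with ha
  have hb : ∀ i j, i ≤ j → 0 ≤ a i j := by
    intro i j hij
    simp only [ha]
    split_ifs with h
    · have h1 := hA.2.2.2 ⟨i - 1, h.2.1⟩ (by simp; omega)
      have h2 := hA.2.1 ⟨i - 1, h.2.1⟩ ⟨i - 1, by omega⟩ ⟨j - 1, h.2.2.2⟩
        (by simp [Fin.le_def]; omega)
      exact h1.le.trans h2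
    · exact le_rfl
  have key := HPX.T_term a hb t c
  have hE : HPX.hpE a (t + 1) (t + c + 1) = hp (t + 1) (t + c + 1) A := by
    unfold HPX.hpE
    congr 1
    funext i j
    have h1 := i.2
    have h2 := j.2
    simp only [ha]
    rw [dif_pos (by omega)]
    rfl
  rw [← hE, key]
  unfold HPX.T
  refine Finset.sum_congr (by congr) fun ι _ => ?_
  unfold HPX.term HPX.ex HPX.J
  rfl
end
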